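/- arXiv:math-ph/0203026 — 5 statements merged into one kernel-verified Lean document; each statement's English description precedes it below -/
import Mathlib

section
/- Let 𝒢 be a measurable groupoid with unit space Ω, ν a transverse function on 𝒢, and μ a ν-invariant measure on Ω with μ(Ω) < ∞ such that 𝒢 is ergodic with respect to μ. Assume the exhaustion property: there exists a sequence (f_n) of nonnegative measurable functions on 𝒢 with 𝒢 = ⋃_n {g : f_n(g) > 0}, with sup-norms ‖f_n‖_∞ → 0 as n → ∞, and with ν^ω(f̃_n) = 1 for all n ∈ ℕ and all ω ∈ Ω (where f̃_n(g) := f_n(g⁻¹)). Then for every transverse function φ on 𝒢, either φ^ω(1) = 0 for μ-almost every ω ∈ Ω, or φ^ω(1) = ∞ for μ-almost every ω ∈ Ω (here φ^ω(1) denotes the total mass φ^ω(𝒢)). -/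
open MeasureTheory
open scoped ENNReal

/-- A measurable groupoid, encoded with a totalized partially-defined multiplication:
`mul g h` is meaningful exactly when `s g = r h`, where the range map is
`r g = mul g (inv g)` and the source map is `s g = mul (inv g) g`. -/
structure MeasGroupoid (G : Type*) [MeasurableSpace G] where
  mul : G → G → G
  inv : G → G
  inv_inv : ∀ g, inv (inv g) = g
  /-- If `g₁·g₂` and `g₂·g₃` exist, then `g₁·g₂·g₃` exists (and multiplication is
  associative there). -/
  mul_assoc' : ∀ g₁ g₂ g₃,
    mul (inv g₁) g₁ = mul g₂ (inv g₂) →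
    mul (inv g₂) g₂ = mul g₃ (inv g₃) →
    mul (inv (mul g₁ g₂)) (mul g₁ g₂) = mul g₃ (inv g₃) ∧
    mul (inv g₁) g₁ = mul (mul g₂ g₃) (inv (mul g₂ g₃)) ∧
    mul (mul g₁ g₂) g₃ = mul g₁ (mul g₂ g₃)
  /-- `g⁻¹·g` exists always and `g⁻¹·g·h = h` whenever `g·h` exists. -/
  inv_mul_cancel_left' : ∀ g h, mul (inv g) g = mul h (inv h) →
    mul (mul (inv g) g) h = h
  /-- `h·h⁻¹` exists always and `g·h·h⁻¹ = g` whenever `g·h` exists. -/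
  mul_inv_cancel_right' : ∀ g h, mul (inv g) g = mul h (inv h) →
    mul (mul g h) (inv h) = g
  measurable_inv : Measurable inv
  measurable_mul : Measurable
    (fun p : {p : G × G // mul (inv p.1) p.1 = mul p.2 (inv p.2)} => mul p.1.1 p.1.2)
  measurable_r : Measurable (fun g => mul g (inv g))
  measurable_s : Measurable (fun g => mul (inv g) g)

namespace MeasGroupoid

variable {G : Type*} [MeasurableSpace G] (𝒢 : MeasGroupoid G)

/-- The range map `r g = g·g⁻¹`. -/
def r (g : G) : G := 𝒢.mul g (𝒢.inv g)

/-- The source map `s g = g⁻¹·g`. -/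
def s (g : G) : G := 𝒢.mul (𝒢.inv g) g

/-- The set of units `Ω = {g·g⁻¹ : g ∈ 𝒢}`. -/
def units : Set G := Set.range 𝒢.r

end MeasGroupoid

/-- A transverse function on a measurable groupoid: a kernel `ω ↦ ν^ω` (each `ν^ω`
supported on the fiber `𝒢^ω = r⁻¹{ω}`, with measurable integrals) satisfying the
invariance condition `∫ f(g·h) dν^{s g}(h) = ∫ f(k) dν^{r g}(k)`. -/
structure TransverseFun {G : Type*} [MeasurableSpace G] (𝒢 : MeasGroupoid G) where
  ν : G → Measure G
  measurable_lintegral : ∀ f : G → ℝ≥0∞, Measurable f →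
    Measurable fun ω : 𝒢.units => ∫⁻ g, f g ∂(ν ω)
  supported : ∀ ω ∈ 𝒢.units, ν ω {g | 𝒢.r g ≠ ω} = 0
  trans : ∀ g : G, ∀ f : G → ℝ≥0∞, Measurable f →
    ∫⁻ h, f (𝒢.mul g h) ∂(ν (𝒢.s g)) = ∫⁻ k, f k ∂(ν (𝒢.r g))

/-- A measurable `𝒢`-space: a measurable fiber map `π : X → Ω` together with a
(totalized) action `J g : X^{s g} → X^{r g}` by isomorphisms of measurable spaces. -/
structure GSpace {G : Type*} [MeasurableSpace G] (𝒢 : MeasGroupoid G)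
    (X : Type*) [MeasurableSpace X] where
  π : X → G
  measurable_π : Measurable π
  π_mem_units : ∀ p, π p ∈ 𝒢.units
  J : G → X → X
  J_fiber : ∀ g p, π p = 𝒢.s g → π (J g p) = 𝒢.r g
  J_inv_left : ∀ g p, π p = 𝒢.s g → J (𝒢.inv g) (J g p) = p
  J_inv_right : ∀ g p, π p = 𝒢.r g → J g (J (𝒢.inv g) p) = p
  J_mul : ∀ g₁ g₂ p, 𝒢.s g₁ = 𝒢.r g₂ → π p = 𝒢.s g₂ →
    J (𝒢.mul g₁ g₂) p = J g₁ (J g₂ p)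
  measurable_J : ∀ g : G, Measurable fun p : {p : X // π p = 𝒢.s g} => J g (p : X)

/-- A random variable (in the sense of Connes) with values in the `𝒢`-space `𝒳`:
a family `ω ↦ α^ω` of measures, `α^ω` supported on the fiber `𝒳^ω`, with measurable
integrals, equivariant under the groupoid action. -/
structure RandomVar {G X : Type*} [MeasurableSpace G] [MeasurableSpace X]
    {𝒢 : MeasGroupoid G} (𝒳 : GSpace 𝒢 X) where
  α : G → Measure X
  measurable_lintegral : ∀ f : X → ℝ≥0∞, Measurable f →
    Measurable fun ω : 𝒢.units => ∫⁻ p, f p ∂(α ω)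
  supported : ∀ ω ∈ 𝒢.units, α ω {p | 𝒳.π p ≠ ω} = 0
  invariant : ∀ g : G, ∀ f : X → ℝ≥0∞, Measurable f →
    ∫⁻ p, f (𝒳.J g p) ∂(α (𝒢.s g)) = ∫⁻ q, f q ∂(α (𝒢.r g))

namespace MeasGroupoid

variable {G : Type*} [MeasurableSpace G] (𝒢 : MeasGroupoid G)

theorem r_inv (g : G) : 𝒢.r (𝒢.inv g) = 𝒢.s g := by
  simp only [r, s, 𝒢.inv_inv]

theorem s_inv (g : G) : 𝒢.s (𝒢.inv g) = 𝒢.r g := by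
  simp only [r, s, 𝒢.inv_inv]

theorem s_mem_units (g : G) : 𝒢.s g ∈ 𝒢.units :=
  ⟨𝒢.inv g, 𝒢.r_inv g⟩

theorem inv_mul {a b : G} (hab : 𝒢.s a = 𝒢.r b) :
    𝒢.inv (𝒢.mul a b) = 𝒢.mul (𝒢.inv b) (𝒢.inv a) := by
  have assoc (x y z : G) (hxy : 𝒢.s x = 𝒢.r y) (hyz : 𝒢.s y = 𝒢.r z) :
      𝒢.s (𝒢.mul x y) = 𝒢.r z ∧ 𝒢.s x = 𝒢.r (𝒢.mul y z) ∧
        𝒢.mul (𝒢.mul x y) z = 𝒢.mul x (𝒢.mul y z) := 𝒢.mul_assoc' x y z hxy hyz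
  set x := 𝒢.mul a b
  set y := 𝒢.mul (𝒢.inv b) (𝒢.inv a)
  have hba : 𝒢.s (𝒢.inv b) = 𝒢.r (𝒢.inv a) := by rw [s_inv, r_inv, hab]
  obtain ⟨hsx, -, -⟩ := assoc a b (𝒢.inv b) hab (𝒢.r_inv b).symm
  obtain ⟨-, hrx, -⟩ := assoc (𝒢.inv a) a b (𝒢.s_inv a) hab
  obtain ⟨-, hxy, hxyab⟩ := assoc x (𝒢.inv b) (𝒢.inv a) hsx hba
  rw [s_inv] at hrx
  have hxa : 𝒢.mul x y = 𝒢.mul a (𝒢.inv a) := by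
    rw [← hxyab]
    congr 1
    exact 𝒢.mul_inv_cancel_right' a b hab
  have hy : 𝒢.mul (𝒢.inv x) (𝒢.mul x y) = y := by
    rw [← (assoc (𝒢.inv x) x y (𝒢.s_inv x) hxy).2.2]
    exact 𝒢.inv_mul_cancel_left' x y hxy
  have hs : 𝒢.s (𝒢.inv x) = 𝒢.r a := by rw [s_inv, hrx]
  rw [← hy, hxa, ← (assoc (𝒢.inv x) a (𝒢.inv a) hs (𝒢.r_inv a).symm).2.2]
  exact (𝒢.mul_inv_cancel_right' (𝒢.inv x) a hs).symm

end MeasGroupoid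

namespace MeasureTheory

variable {α : Type*} [MeasurableSpace α] {m : Measure α} {S : Set α}

/-- A conull set need not be measurable, but it carries the whole measure. -/
theorem map_coe_comap_coe_of_measure_compl_eq_zero (hS : m Sᶜ = 0) :
    (m.comap ((↑) : S → α)).map (↑) = m := by
  have hSn : NullMeasurableSet S m := by
    simpa using (NullMeasurableSet.of_null hS).compl
  ext t ht
  rw [Measure.map_apply measurable_subtype_coe ht,
    Measure.comap_apply₀ _ _ Subtype.val_injective _
      (measurable_subtype_coe ht).nullMeasurableSet, Subtype.image_preimage_coe,
    Set.inter_comm]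
  · exact measure_inter_conull hS
  · rintro u ⟨v, hv, rfl⟩
    rw [Subtype.image_preimage_coe]
    exact hSn.inter hv.nullMeasurableSet

theorem lintegral_comap_coe_of_measure_compl_eq_zero (hS : m Sᶜ = 0) {u : α → ℝ≥0∞}
    (hu : Measurable fun x : S => u x) :
    ∫⁻ x : S, u x ∂(m.comap (↑)) = ∫⁻ x, u x ∂m := by
  obtain ⟨v, hv, huv⟩ := Measurable.exists_eq_measurable_comp (f := ((↑) : S → α)) hu
  have hae : u =ᵐ[m] v := by
    filter_upwards [show ∀ᵐ x ∂m, x ∈ S from hS] with x hx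
    exact congrFun huv ⟨x, hx⟩
  rw [lintegral_congr_ae hae]
  conv_rhs => rw [← map_coe_comap_coe_of_measure_compl_eq_zero hS]
  rw [lintegral_map hv measurable_subtype_coe]
  exact lintegral_congr (congrFun huv)

theorem sFinite_of_lintegral_ne_top {f : ℕ → α → ℝ≥0∞} (hf : ∀ n, Measurable (f n))
    (hpos : ∀ x, ∃ n, 0 < f n x) (hint : ∀ n, ∫⁻ x, f n x ∂m = 1) : SFinite m := by
  have hF : Measurable fun x => ∑' n, (2⁻¹ : ℝ≥0∞) ^ n * f n x :=
    Measurable.tsum fun n => (hf n).const_mul _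
  have hFint : ∫⁻ x, ∑' n, (2⁻¹ : ℝ≥0∞) ^ n * f n x ∂m ≠ ∞ := by
    rw [lintegral_tsum fun n => ((hf n).const_mul _).aemeasurable]
    simp [lintegral_const_mul _ (hf _), hint, ENNReal.tsum_geometric]
  have hF0 (x) : ∑' n, (2⁻¹ : ℝ≥0∞) ^ n * f n x ≠ 0 := by
    obtain ⟨n, hn⟩ := hpos x
    exact fun h => mul_ne_zero (by simp) hn.ne' (ENNReal.tsum_eq_zero.mp h n)
  have : IsFiniteMeasure (m.withDensity fun x => ∑' n, (2⁻¹ : ℝ≥0∞) ^ n * f n x) :=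
    isFiniteMeasure_withDensity hFint
  rw [← withDensity_inv_same hF (Filter.Eventually.of_forall hF0)
    ((ae_lt_top hF hFint).mono fun _ h => h.ne)]
  infer_instance

end MeasureTheory

namespace TransverseFun

variable {G : Type*} [MeasurableSpace G] {𝒢 : MeasGroupoid G}

theorem measure_compl_fiber (ν : TransverseFun 𝒢) {ω : G} (hω : ω ∈ 𝒢.units) :
    ν.ν ω {g | 𝒢.r g = ω}ᶜ = 0 :=
  ν.supported ω hω

theorem ae_r_eq (ν : TransverseFun 𝒢) {ω : G} (hω : ω ∈ 𝒢.units) :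
    ∀ᵐ g ∂(ν.ν ω), 𝒢.r g = ω :=
  ν.supported ω hω

theorem lintegral_inv_mul (ν : TransverseFun 𝒢) (g : G) {f : G → ℝ≥0∞} (hf : Measurable f) :
    ∫⁻ h, f (𝒢.mul (𝒢.inv g) h) ∂(ν.ν (𝒢.r g)) = ∫⁻ k, f k ∂(ν.ν (𝒢.s g)) := by
  simpa only [𝒢.s_inv, 𝒢.r_inv] using ν.trans (𝒢.inv g) f hf

theorem measurable_lintegral_s (ν : TransverseFun 𝒢) {f : G → ℝ≥0∞} (hf : Measurable f) :
    Measurable fun g => ∫⁻ h, f h ∂(ν.ν (𝒢.s g)) :=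
  (ν.measurable_lintegral f hf).comp
    (𝒢.measurable_s.subtype_mk : Measurable fun g => (⟨𝒢.s g, 𝒢.s_mem_units g⟩ : 𝒢.units))

/-- The total mass of a transverse function is an invariant function. -/
theorem mass_r_eq_mass_s (ν : TransverseFun 𝒢) (g : G) :
    ν.ν (𝒢.r g) Set.univ = ν.ν (𝒢.s g) Set.univ := by
  simpa using (ν.trans g 1 measurable_one).symm

/-- Convolving two transverse functions in either order gives the same integral. -/
theorem lintegral_lintegral_comm (ν φ : TransverseFun 𝒢) {ω : G} (hω : ω ∈ 𝒢.units)
    [SFinite ((ν.ν ω).comap ((↑) : {g | 𝒢.r g = ω} → G))]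
    [SFinite ((φ.ν ω).comap ((↑) : {g | 𝒢.r g = ω} → G))]
    {f : G → ℝ≥0∞} (hf : Measurable f) :
    ∫⁻ k, (∫⁻ g, f g ∂(φ.ν (𝒢.s k))) ∂(ν.ν ω) =
      ∫⁻ h, (∫⁻ g, f (𝒢.inv g) ∂(ν.ν (𝒢.s h))) ∂(φ.ν ω) := by
  have hfinv : Measurable fun g => f (𝒢.inv g) := hf.comp 𝒢.measurable_inv
  have hmul : Measurable fun p : {g | 𝒢.r g = ω} × {g | 𝒢.r g = ω} =>
      f (𝒢.mul (𝒢.inv p.1) p.2) := by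
    have hp : Measurable fun p : {g | 𝒢.r g = ω} × {g | 𝒢.r g = ω} =>
        (⟨(𝒢.inv p.1, p.2), (𝒢.s_inv p.1).trans (p.1.2.trans p.2.2.symm)⟩ :
          {p : G × G // 𝒢.mul (𝒢.inv p.1) p.1 = 𝒢.mul p.2 (𝒢.inv p.2)}) :=
      ((𝒢.measurable_inv.comp (measurable_subtype_coe.comp measurable_fst)).prodMk
        (measurable_subtype_coe.comp measurable_snd)).subtype_mk
    exact hf.comp (𝒢.measurable_mul.comp hp)
  rw [← lintegral_comap_coe_of_measure_compl_eq_zero (ν.measure_compl_fiber hω)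
      ((φ.measurable_lintegral_s hf).comp measurable_subtype_coe),
    ← lintegral_comap_coe_of_measure_compl_eq_zero (φ.measure_compl_fiber hω)
      ((ν.measurable_lintegral_s hfinv).comp measurable_subtype_coe)]
  calc
    _ = ∫⁻ k : {g | 𝒢.r g = ω}, ∫⁻ h : {g | 𝒢.r g = ω}, f (𝒢.mul (𝒢.inv k) h)
          ∂((φ.ν ω).comap (↑)) ∂((ν.ν ω).comap (↑)) := by
      refine lintegral_congr fun k => ?_
      rw [lintegral_comap_coe_of_measure_compl_eq_zero (u := fun h => f (𝒢.mul (𝒢.inv k) h))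
        (φ.measure_compl_fiber hω) (hmul.comp (measurable_const.prodMk measurable_id)),
        ← φ.lintegral_inv_mul k hf, show 𝒢.r k = ω from k.2]
    _ = ∫⁻ h : {g | 𝒢.r g = ω}, ∫⁻ k : {g | 𝒢.r g = ω}, f (𝒢.mul (𝒢.inv k) h)
          ∂((ν.ν ω).comap (↑)) ∂((φ.ν ω).comap (↑)) :=
      lintegral_lintegral_swap hmul.aemeasurable
    _ = _ := by
      refine lintegral_congr fun h => ?_
      rw [lintegral_comap_coe_of_measure_compl_eq_zero (u := fun k => f (𝒢.mul (𝒢.inv k) h))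
        (ν.measure_compl_fiber hω) (hmul.comp (measurable_id.prodMk measurable_const)),
        ← ν.lintegral_inv_mul h hfinv, show 𝒢.r h = ω from h.2]
      refine lintegral_congr_ae ((ν.ae_r_eq hω).mono fun k hk => ?_)
      have hhk : 𝒢.s (𝒢.inv h) = 𝒢.r k := by
        rw [𝒢.s_inv, hk]
        exact h.2
      simp only [𝒢.inv_mul hhk, 𝒢.inv_inv]

end TransverseFun

/-- Normalized functions with sup-norms tending to zero force infinite total mass. -/
theorem MeasureTheory.measure_univ_eq_top_of_tendsto_iSup {α : Type*} [MeasurableSpace α]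
    {m : Measure α} {f : ℕ → α → ℝ≥0∞}
    (hsup : Filter.Tendsto (fun n => ⨆ x, f n x) Filter.atTop (nhds 0))
    {T : α → α} (hint : ∀ n, ∫⁻ x, f n (T x) ∂m = 1) : m Set.univ = ∞ := by
  by_contra hm
  have hle (n : ℕ) : 1 ≤ (⨆ x, f n x) * m Set.univ := by
    rw [← hint n, ← lintegral_const]
    exact lintegral_mono fun x => le_iSup (f n) (T x)
  have h := ENNReal.Tendsto.mul_const (b := m Set.univ) hsup (.inr hm)
  rw [zero_mul] at h
  exact absurd (ge_of_tendsto' h hle) (by simp)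

/-- Lemma `key`: let `𝒢` be a measurable groupoid with transverse
function `ν` and finite `ν`-invariant measure `μ` on the unit space, ergodic with
respect to `μ` (every invariant measurable function on the units is `μ`-a.e.
constant). Assume the exhaustion property: there is a sequence `(fₙ)` of nonnegative
measurable functions on `𝒢` with `𝒢 = ⋃ₙ {g : fₙ g > 0}`, `‖fₙ‖_∞ → 0`, and
`ν^ω(f̃ₙ) = 1` for all `n` and all units `ω`. Then for every transverse function `φ`,
either `φ^ω(1) = 0` for `μ`-a.e. `ω`, or `φ^ω(1) = ∞` for `μ`-a.e. `ω`. -/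
theorem transverse_function_dichotomy
    {G : Type*} [MeasurableSpace G] (𝒢 : MeasGroupoid G)
    (ν : TransverseFun 𝒢) (μ : Measure G) [IsFiniteMeasure μ]
    (hμ_supp : μ 𝒢.unitsᶜ = 0)
    (hμ_inv : ∀ f : G → ℝ≥0∞, Measurable f →
      ∫⁻ ω, (∫⁻ g, f g ∂(ν.ν ω)) ∂μ = ∫⁻ ω, (∫⁻ g, f (𝒢.inv g) ∂(ν.ν ω)) ∂μ)
    (h_erg : ∀ f : G → ℝ≥0∞, (Measurable fun ω : 𝒢.units => f ω) →
      (∀ g : G, f (𝒢.r g) = f (𝒢.s g)) → ∃ c : ℝ≥0∞, ∀ᵐ ω ∂μ, f ω = c)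
    (fs : ℕ → G → ℝ≥0∞) (hfs_meas : ∀ n, Measurable (fs n))
    (hfs_cover : ∀ g : G, ∃ n, 0 < fs n g)
    (hfs_sup : Filter.Tendsto (fun n => ⨆ g, fs n g) Filter.atTop (nhds 0))
    (hfs_norm : ∀ n, ∀ ω ∈ 𝒢.units, ∫⁻ g, fs n (𝒢.inv g) ∂(ν.ν ω) = 1)
    (φ : TransverseFun 𝒢) :
    (∀ᵐ ω ∂μ, φ.ν ω Set.univ = 0) ∨ (∀ᵐ ω ∂μ, φ.ν ω Set.univ = ∞) := by
  obtain ⟨c, hc⟩ := h_erg (fun ω => φ.ν ω Set.univ)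
    (by simpa using φ.measurable_lintegral 1 measurable_one) φ.mass_r_eq_mass_s
  rcases eq_or_ne c 0 with rfl | hc0
  · exact .inl hc
  rcases eq_or_ne c ∞ with rfl | hctop
  · exact .inr hc
  rcases eq_or_ne μ 0 with rfl | hμ0
  · simp
  exfalso
  have hunits : ∀ᵐ ω ∂μ, ω ∈ 𝒢.units := hμ_supp
  have hleft : ∫⁻ ω, (∫⁻ k, (∫⁻ g, fs 0 g ∂(φ.ν (𝒢.s k))) ∂(ν.ν ω)) ∂μ =
      c * μ Set.univ := by
    rw [← lintegral_const]
    refine lintegral_congr_ae ?_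
    filter_upwards [hunits, hc] with ω hω hcω
    have : SFinite ((ν.ν ω).comap ((↑) : {g | 𝒢.r g = ω} → G)) := by
      refine sFinite_of_lintegral_ne_top (f := fun n g => fs n (𝒢.inv g))
        (fun n => ((hfs_meas n).comp 𝒢.measurable_inv).comp measurable_subtype_coe)
        (fun g => hfs_cover _) fun n => ?_
      rw [← hfs_norm n ω hω]
      exact lintegral_comap_coe_of_measure_compl_eq_zero (u := fun g => fs n (𝒢.inv g))
        (ν.measure_compl_fiber hω)
        (((hfs_meas n).comp 𝒢.measurable_inv).comp measurable_subtype_coe)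
    have : IsFiniteMeasure ((φ.ν ω).comap ((↑) : {g | 𝒢.r g = ω} → G)) := by
      refine ⟨?_⟩
      have h := lintegral_comap_coe_of_measure_compl_eq_zero (u := 1)
        (φ.measure_compl_fiber hω) measurable_one
      simp only [Pi.one_apply, lintegral_one] at h
      exact (h.trans hcω).trans_lt hctop.lt_top
    rw [ν.lintegral_lintegral_comm φ hω (hfs_meas 0)]
    simp only [hfs_norm 0 _ (𝒢.s_mem_units _), lintegral_one, hcω]
  have hright : ∫⁻ ω, (∫⁻ k, (∫⁻ g, fs 0 g ∂(φ.ν (𝒢.s k))) ∂(ν.ν ω)) ∂μ =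
      ∫⁻ ω, (∫⁻ g, fs 0 g ∂(φ.ν ω)) * ∞ ∂μ := by
    rw [hμ_inv _ (φ.measurable_lintegral_s (hfs_meas 0))]
    refine lintegral_congr_ae (hunits.mono fun ω hω => ?_)
    simp only [𝒢.s_inv]
    rw [← measure_univ_eq_top_of_tendsto_iSup hfs_sup fun n => hfs_norm n ω hω,
      ← lintegral_const]
    exact lintegral_congr_ae ((ν.ae_r_eq hω).mono fun k hk => by simp only [hk])
  have hdouble : 2 * (c * μ Set.univ) = c * μ Set.univ := by
    rw [← hleft, hright, ← lintegral_const_mul' _ _ (by simp)]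
    simp only [mul_left_comm (2 : ℝ≥0∞), ENNReal.mul_top two_ne_zero]
  have hfin : c * μ Set.univ ≠ ∞ := ENNReal.mul_ne_top hctop (measure_ne_top μ _)
  have hzero : c * μ Set.univ = 0 := by
    rw [two_mul] at hdouble
    exact (ENNReal.add_right_inj hfin).mp (hdouble.trans (add_zero _).symm)
  exact mul_ne_zero hc0 (by simpa using hμ0) hzero
end

section
/- Let 𝒩 be a von Neumann algebra acting on a separable complex Hilbert space ℋ, and let 𝓘 ⊆ 𝒩 be a right ideal (a linear subspace of 𝒩 with AB ∈ 𝓘 whenever A ∈ 𝓘 and B ∈ 𝒩) such that the closed linear span of {A*B x : A, B ∈ 𝓘, x ∈ ℋ} equals ℋ. Let τ be a normal weight on 𝒩 satisfying τ(A*A) = τ(AA*) for all A ∈ 𝓘. Then τ is a trace, i.e. τ(U A U*) = τ(A) for every nonnegative A ∈ 𝒩 and every unitary U ∈ 𝒩. -/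
open scoped ENNReal InnerProductSpace
open Filter Topology

section WeightTrace

variable {H : Type*} [NormedAddCommGroup H] [InnerProductSpace ℂ H] [CompleteSpace H]

theorem VonNeumannAlgebra.rpow_mem (N : VonNeumannAlgebra H) {a : H →L[ℂ] H} (ha : a ∈ N)
    (r : ℝ) : a ^ r ∈ N := by
  rw [← N.commutant_commutant, VonNeumannAlgebra.mem_commutant_iff]
  intro g hg
  have hag : Commute a g := VonNeumannAlgebra.mem_commutant_iff.mp hg a ha
  exact (hag.cfc_nnreal _).symm.eq

/-- The operator `1 + n ∑_{i < n} (A i)* (A i)`. -/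
noncomputable def onePlusGram (A : ℕ → H →L[ℂ] H) (n : ℕ) : H →L[ℂ] H :=
  1 + n • ∑ i ∈ Finset.range n, star (A i) * A i

theorem gram_nonneg (A : ℕ → H →L[ℂ] H) (s : Finset ℕ) :
    0 ≤ ∑ i ∈ s, star (A i) * A i :=
  Finset.sum_nonneg fun i _ => star_mul_self_nonneg (A i)

theorem onePlusGram_isStrictlyPositive (A : ℕ → H →L[ℂ] H) (n : ℕ) :
    IsStrictlyPositive (onePlusGram A n) :=
  isStrictlyPositive_one.add_nonneg (nsmul_nonneg (gram_nonneg A _) n)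

theorem onePlusGram_le_succ (A : ℕ → H →L[ℂ] H) (n : ℕ) :
    onePlusGram A n ≤ onePlusGram A (n + 1) := by
  unfold onePlusGram
  rw [Finset.sum_range_succ]
  have h : n • ∑ i ∈ Finset.range n, star (A i) * A i ≤
      (n + 1) • ∑ i ∈ Finset.range n, star (A i) * A i :=
    nsmul_le_nsmul_left (gram_nonneg A _) n.le_succ
  have h' := nsmul_nonneg (star_mul_self_nonneg (A n)) (n + 1)
  rw [smul_add]
  exact add_le_add_right (h.trans (le_add_of_nonneg_right h')) 1

theorem re_inner_onePlusGram (A : ℕ → H →L[ℂ] H) (n : ℕ) (v : H) :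
    (⟪v, onePlusGram A n v⟫_ℂ).re =
      ‖v‖ ^ 2 + n * ∑ i ∈ Finset.range n, ‖A i v‖ ^ 2 := by
  have h : ∀ i, ⟪v, (star (A i)) (A i v)⟫_ℂ = ((‖A i v‖ ^ 2 : ℝ) : ℂ) := fun i => by
    rw [ContinuousLinearMap.star_eq_adjoint, ContinuousLinearMap.adjoint_inner_right,
      inner_self_eq_norm_sq_to_K]
    simp
  have hv : ⟪v, v⟫_ℂ = ((‖v‖ ^ 2 : ℝ) : ℂ) := by
    rw [inner_self_eq_norm_sq_to_K]
    simp
  simp only [onePlusGram, add_apply, one_apply_eq_self, smul_apply, sum_apply,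
    mul_apply_eq_comp, inner_add_right, inner_sum, hv, ← Nat.cast_smul_eq_nsmul ℂ,
    inner_smul_right, h]
  norm_cast

theorem onePlusGram_apply_rpow_neg_one (A : ℕ → H →L[ℂ] H) (n : ℕ) (w : H) :
    onePlusGram A n ((onePlusGram A n ^ (-1 : ℝ)) w) = w := by
  have hP := onePlusGram_isStrictlyPositive A n
  have h : onePlusGram A n * onePlusGram A n ^ (-1 : ℝ) = 1 := by
    conv_lhs => enter [1]; rw [← CFC.rpow_one (onePlusGram A n) hP.nonneg]
    exact CFC.rpow_mul_rpow_neg 1 hP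
  simpa using congrArg (fun T : H →L[ℂ] H => T w) h

theorem norm_onePlusGram_rpow_neg_one_apply_le (A : ℕ → H →L[ℂ] H) (n : ℕ) (w : H) :
    ‖(onePlusGram A n ^ (-1 : ℝ)) w‖ ≤ ‖w‖ := by
  set v := (onePlusGram A n ^ (-1 : ℝ)) w with hv
  have h := re_inner_onePlusGram A n v
  rw [hv, onePlusGram_apply_rpow_neg_one, ← hv] at h
  have h1 : (⟪v, w⟫_ℂ).re ≤ ‖v‖ * ‖w‖ := re_inner_le_norm (𝕜 := ℂ) v w
  have h2 : 0 ≤ (n : ℝ) * ∑ i ∈ Finset.range n, ‖A i v‖ ^ 2 := by positivity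
  by_contra! hlt
  nlinarith [norm_nonneg w]

theorem mul_norm_onePlusGram_rpow_neg_one_star_apply_sq_le (A : ℕ → H →L[ℂ] H) {m n : ℕ}
    (hmn : m < n) (z : H) :
    n * ‖(onePlusGram A n ^ (-1 : ℝ)) (star (A m) z)‖ ^ 2 ≤ ‖z‖ ^ 2 := by
  set v := (onePlusGram A n ^ (-1 : ℝ)) (star (A m) z) with hv
  have h := re_inner_onePlusGram A n v
  rw [hv, onePlusGram_apply_rpow_neg_one, ← hv, ContinuousLinearMap.star_eq_adjoint,
    ContinuousLinearMap.adjoint_inner_right] at h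
  have h1 : (⟪A m v, z⟫_ℂ).re ≤ ‖A m v‖ * ‖z‖ := re_inner_le_norm (𝕜 := ℂ) _ _
  have h2 : ‖A m v‖ ^ 2 ≤ ∑ i ∈ Finset.range n, ‖A i v‖ ^ 2 :=
    Finset.single_le_sum (f := fun i => ‖A i v‖ ^ 2) (fun i _ => by positivity)
      (Finset.mem_range.mpr hmn)
  have hn : (0 : ℝ) ≤ n := n.cast_nonneg
  have h3 := mul_le_mul_of_nonneg_left h2 hn
  have h4 : ‖v‖ ^ 2 + n * ‖A m v‖ ^ 2 ≤ ‖A m v‖ * ‖z‖ := by linarith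
  nlinarith [mul_le_mul_of_nonneg_left h4 hn, sq_nonneg (n * ‖A m v‖ - ‖z‖),
    sq_nonneg (n * ‖A m v‖)]

theorem tendsto_onePlusGram_rpow_neg_one_apply (A : ℕ → H →L[ℂ] H)
    (hA : Dense (Submodule.span ℂ {y : H | ∃ i z, y = star (A i) z} : Set H)) (x : H) :
    Tendsto (fun n => (onePlusGram A n ^ (-1 : ℝ)) x) atTop (𝓝 0) := by
  have hspan : ∀ y ∈ Submodule.span ℂ {y : H | ∃ i z, y = star (A i) z},
      Tendsto (fun n => (onePlusGram A n ^ (-1 : ℝ)) y) atTop (𝓝 0) := by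
    intro y hy
    induction hy using Submodule.span_induction with
    | mem y hy =>
      obtain ⟨m, z, rfl⟩ := hy
      have hlim : Tendsto (fun n : ℕ => ‖z‖ ^ 2 / (n : ℝ)) atTop (𝓝 0) :=
        tendsto_const_div_atTop_nhds_zero_nat _
      have hsq : Tendsto
          (fun n => ‖(onePlusGram A n ^ (-1 : ℝ)) (star (A m) z)‖ ^ 2) atTop (𝓝 0) := by
        refine squeeze_zero' (.of_forall fun n => by positivity) ?_ hlim
        filter_upwards [eventually_gt_atTop m] with n hn
        rw [le_div_iff₀' (by exact_mod_cast (Nat.zero_le m).trans_lt hn)]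
        exact mul_norm_onePlusGram_rpow_neg_one_star_apply_sq_le A hn z
      have := hsq.sqrt
      simp only [Real.sqrt_zero, Real.sqrt_sq (norm_nonneg _)] at this
      exact tendsto_zero_iff_norm_tendsto_zero.mpr this
    | zero => simp
    | add y z _ _ hy hz => simpa using hy.add hz
    | smul c y _ hy => simpa using hy.const_smul c
  rw [Metric.tendsto_atTop]
  intro ε hε
  obtain ⟨y, hy, hxy⟩ := Metric.dense_iff.mp hA x (ε / 2) (half_pos hε)
  obtain ⟨M, hM⟩ := Metric.tendsto_atTop.mp (hspan y hxy) (ε / 2) (half_pos hε)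
  refine ⟨M, fun n hn => ?_⟩
  have h1 := hM n hn
  have h2 := norm_onePlusGram_rpow_neg_one_apply_le A n (x - y)
  rw [Metric.mem_ball, dist_comm, dist_eq_norm] at hy
  rw [dist_zero_right] at h1 ⊢
  rw [map_sub] at h2
  linarith [norm_le_norm_sub_add ((onePlusGram A n ^ (-1 : ℝ)) x)
    ((onePlusGram A n ^ (-1 : ℝ)) y)]

theorem sum_star_mul_self_eq_one_sub (A : ℕ → H →L[ℂ] H) (n : ℕ) :
    ∑ i ∈ Finset.range n,
        star (((√n : ℝ) : ℂ) • (A i * onePlusGram A n ^ (-(1 / 2) : ℝ))) *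
          (((√n : ℝ) : ℂ) • (A i * onePlusGram A n ^ (-(1 / 2) : ℝ))) =
      1 - onePlusGram A n ^ (-1 : ℝ) := by
  have hP := onePlusGram_isStrictlyPositive A n
  set T := onePlusGram A n ^ (-(1 / 2) : ℝ) with hT
  have hstar : star T = T := (IsSelfAdjoint.of_nonneg CFC.rpow_nonneg).star_eq
  have hTT : T * T = onePlusGram A n ^ (-1 : ℝ) := by
    rw [hT, ← CFC.rpow_add hP.isUnit]
    norm_num
  have hone : T * onePlusGram A n * T = 1 := CFC.conjugate_rpow_neg_one_half _ hP
  have hsqrt : ((√n : ℝ) : ℂ) * ((√n : ℝ) : ℂ) = n := by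
    exact_mod_cast Real.mul_self_sqrt n.cast_nonneg
  have hterm : ∀ i, star (((√n : ℝ) : ℂ) • (A i * T)) * (((√n : ℝ) : ℂ) • (A i * T)) =
      T * (n • (star (A i) * A i)) * T := fun i => by
    rw [star_smul, star_mul, hstar, smul_mul_smul_comm, Complex.star_def, Complex.conj_ofReal,
      hsqrt, Nat.cast_smul_eq_nsmul]
    simp only [mul_smul_comm, smul_mul_assoc, mul_assoc]
  rw [Finset.sum_congr rfl fun i _ => hterm i, ← Finset.sum_mul, ← Finset.mul_sum,
    ← Finset.smul_sum, ← hTT]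
  calc T * (n • ∑ i ∈ Finset.range n, star (A i) * A i) * T
      = T * (onePlusGram A n - 1) * T := by rw [onePlusGram, add_sub_cancel_left]
    _ = 1 - T * T := by rw [mul_sub, sub_mul, hone, mul_one]

theorem exists_seq_dense_span_star_range [TopologicalSpace.SeparableSpace H]
    {I : Set (H →L[ℂ] H)} (hne : I.Nonempty)
    (hI : Dense (Submodule.span ℂ
      {y : H | ∃ A ∈ I, ∃ B ∈ I, ∃ x : H, y = (star A * B) x} : Set H)) :
    ∃ A : ℕ → H →L[ℂ] H, (∀ i, A i ∈ I) ∧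
      Dense (Submodule.span ℂ {y : H | ∃ i z, y = star (A i) z} : Set H) := by
  obtain ⟨t, hts, htc, htd⟩ :=
    (TopologicalSpace.IsSeparable.of_separableSpace
      {y : H | ∃ A ∈ I, ∃ z : H, y = star A z}).exists_countable_dense_subset
  have hts' : ∀ y ∈ t, ∃ A ∈ I, ∃ z : H, y = star A z := fun y hy => hts hy
  choose! F hF z hz using hts'
  obtain ⟨A₀, hA₀⟩ := hne
  obtain ⟨A, hA⟩ := ((htc.image F).insert A₀).exists_eq_range (Set.insert_nonempty _ _)
  refine ⟨A, fun i => ?_, ?_⟩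
  · have hi : A i ∈ insert A₀ (F '' t) := hA ▸ Set.mem_range_self i
    rcases hi with hi | ⟨y, hy, hi⟩
    · exact hi ▸ hA₀
    · exact hi ▸ hF y hy
  · have ht : t ⊆ Submodule.span ℂ {y : H | ∃ i z, y = star (A i) z} := fun y hy => by
      obtain ⟨i, hi⟩ : F y ∈ Set.range A := hA ▸ Or.inr ⟨y, hy, rfl⟩
      exact Submodule.subset_span ⟨i, z y, hi ▸ hz y hy⟩
    rw [Submodule.dense_iff_topologicalClosure_eq_top] at hI ⊢
    rw [eq_top_iff, ← hI]
    refine Submodule.topologicalClosure_minimal _ (Submodule.span_le.mpr ?_)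
      (Submodule.isClosed_topologicalClosure _)
    rintro y ⟨C, hC, B, -, x, rfl⟩
    exact closure_mono ht (htd ⟨C, hC, B x, rfl⟩)

theorem weight_sum_star_mul_self (N : VonNeumannAlgebra H) (τ : (H →L[ℂ] H) → ℝ≥0∞)
    (hτ_zero : τ 0 = 0)
    (hτ_add : ∀ A B : H →L[ℂ] H, A ∈ N → B ∈ N → A.IsPositive → B.IsPositive →
      τ (A + B) = τ A + τ B)
    (D : ℕ → H →L[ℂ] H) (hD : ∀ i, D i ∈ N) (s : Finset ℕ) :
    τ (∑ i ∈ s, star (D i) * D i) = ∑ i ∈ s, τ (star (D i) * D i) := by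
  induction s using Finset.induction_on with
  | empty => simpa using hτ_zero
  | insert i s hi ih =>
    rw [Finset.sum_insert hi, Finset.sum_insert hi, hτ_add _ _ (mul_mem (star_mem (hD i)) (hD i))
      (sum_mem fun j _ => mul_mem (star_mem (hD j)) (hD j)) _ _, ih]
    · exact (ContinuousLinearMap.nonneg_iff_isPositive _).mp (star_mul_self_nonneg (D i))
    · exact (ContinuousLinearMap.nonneg_iff_isPositive _).mp (gram_nonneg D s)

end WeightTrace



/-- Lemma `spur`: let `𝒩` be a von Neumann algebra on a separable
complex Hilbert space `ℋ`, and `𝓘 ⊆ 𝒩` a right ideal such that the closed linear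
span of `{A* B x : A, B ∈ 𝓘, x ∈ ℋ}` is all of `ℋ`. If `τ` is a normal weight on `𝒩`
with `τ(A*A) = τ(AA*)` for all `A ∈ 𝓘`, then `τ` is a trace: `τ(U A U*) = τ(A)` for
every nonnegative `A ∈ 𝒩` and every unitary `U ∈ 𝒩`. -/
theorem normal_weight_is_trace_of_right_ideal
    {H : Type*} [NormedAddCommGroup H] [InnerProductSpace ℂ H] [CompleteSpace H]
    [TopologicalSpace.SeparableSpace H]
    (N : VonNeumannAlgebra H) (I : Set (H →L[ℂ] H))
    (hI_sub : ∀ A ∈ I, A ∈ N)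
    (hI_add : ∀ A ∈ I, ∀ B ∈ I, A + B ∈ I)
    (hI_smul : ∀ (c : ℂ), ∀ A ∈ I, c • A ∈ I)
    (hI_mul : ∀ A ∈ I, ∀ B ∈ N, A * B ∈ I)
    (hI_dense : Dense (Submodule.span ℂ
      {y : H | ∃ A ∈ I, ∃ B ∈ I, ∃ x : H, y = (star A * B) x} : Set H))
    (τ : (H →L[ℂ] H) → ℝ≥0∞)
    (hτ_add : ∀ A B : H →L[ℂ] H, A ∈ N → B ∈ N → A.IsPositive → B.IsPositive →
      τ (A + B) = τ A + τ B)
    (hτ_smul : ∀ (c : NNReal) (A : H →L[ℂ] H), A ∈ N → A.IsPositive →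
      τ ((c : ℂ) • A) = (c : ℝ≥0∞) * τ A)
    (hτ_normal : ∀ (As : ℕ → (H →L[ℂ] H)) (A : H →L[ℂ] H),
      (∀ n, As n ∈ N) → A ∈ N → (∀ n, (As n).IsPositive) → A.IsPositive →
      (∀ n, (As (n + 1) - As n).IsPositive) →
      (∀ x : H, Filter.Tendsto (fun n => As n x) Filter.atTop (nhds (A x))) →
      Filter.Tendsto (fun n => τ (As n)) Filter.atTop (nhds (τ A)))
    (hτ_I : ∀ A ∈ I, τ (star A * A) = τ (A * star A)) :
    ∀ A : H →L[ℂ] H, A ∈ N → A.IsPositive →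
      ∀ U : H →L[ℂ] H, U ∈ N → U ∈ unitary (H →L[ℂ] H) →
        τ (U * A * star U) = τ A := by
  rcases I.eq_empty_or_nonempty with rfl | hne
  · have hsub : Subsingleton H := by
      have hbot := Submodule.dense_iff_topologicalClosure_eq_top.mp hI_dense
      simp only [Set.mem_empty_iff_false, false_and, exists_false, Set.ofPred_false,
        Submodule.span_empty] at hbot
      rw [IsClosed.submodule_topologicalClosure_eq (by simp)] at hbot
      exact (Submodule.subsingleton_iff ℂ).mp (subsingleton_of_bot_eq_top hbot)
    intro A _ _ U _ _
    exact congrArg τ (ContinuousLinearMap.ext fun x => Subsingleton.elim _ _)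
  obtain ⟨A, hAI, hAd⟩ := exists_seq_dense_span_star_range hne hI_dense
  have hτ_zero : τ 0 = 0 := by
    simpa using hτ_smul 0 0 (zero_mem N) ContinuousLinearMap.isPositive_zero
  have hPN : ∀ n, onePlusGram A n ∈ N := fun n =>
    add_mem (one_mem N) (nsmul_mem (sum_mem fun i _ =>
      mul_mem (star_mem (hI_sub _ (hAI i))) (hI_sub _ (hAI i))) n)
  let D : ℕ → ℕ → H →L[ℂ] H := fun n i =>
    ((√n : ℝ) : ℂ) • (A i * onePlusGram A n ^ (-(1 / 2) : ℝ))
  have hDI : ∀ n i, D n i ∈ I := fun n i =>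
    hI_smul _ _ (hI_mul _ (hAI i) _ (N.rpow_mem (hPN n) _))
  let E : ℕ → H →L[ℂ] H := fun n => 1 - onePlusGram A n ^ (-1 : ℝ)
  have hE : ∀ n, ∑ i ∈ Finset.range n, star (D n i) * D n i = E n :=
    sum_star_mul_self_eq_one_sub A
  have hEN : ∀ n, E n ∈ N := fun n => sub_mem (one_mem N) (N.rpow_mem (hPN n) _)
  have hE_nonneg : ∀ n, 0 ≤ E n := fun n => hE n ▸ gram_nonneg (D n) _
  have key : ∀ B ∈ N, Tendsto
      (fun n => ∑ i ∈ Finset.range n, τ (D n i * (star B * B) * star (D n i))) atTop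
      (𝓝 (τ (B * star B))) := by
    intro B hB
    have hsum : ∀ n, τ (B * E n * star B) =
        ∑ i ∈ Finset.range n, τ (D n i * (star B * B) * star (D n i)) := fun n => by
      have hDB : ∀ i, D n i * star B ∈ I := fun i => hI_mul _ (hDI n i) _ (star_mem hB)
      have hconj : B * E n * star B =
          ∑ i ∈ Finset.range n, star (D n i * star B) * (D n i * star B) := by
        rw [← hE, Finset.mul_sum, Finset.sum_mul]
        simp only [star_mul, star_star, mul_assoc]
      rw [hconj, weight_sum_star_mul_self N τ hτ_zero hτ_add _ fun i => hI_sub _ (hDB i)]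
      refine Finset.sum_congr rfl fun i _ => ?_
      rw [hτ_I _ (hDB i)]
      simp only [star_mul, star_star, mul_assoc]
    simp only [← hsum]
    refine hτ_normal _ _ (fun n => mul_mem (mul_mem hB (hEN n)) (star_mem hB))
      (mul_mem hB (star_mem hB)) (fun n => ?_) ?_ (fun n => ?_) fun x => ?_
    · exact (ContinuousLinearMap.nonneg_iff_isPositive _).mp
        (star_right_conjugate_nonneg (hE_nonneg n) B)
    · exact (ContinuousLinearMap.nonneg_iff_isPositive _).mp (mul_star_self_nonneg B)
    · rw [← ContinuousLinearMap.le_def]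
      exact star_right_conjugate_le_conjugate (sub_le_sub_left
        (CStarAlgebra.rpow_neg_one_le_rpow_neg_one (onePlusGram_le_succ A n)
          (onePlusGram_isStrictlyPositive A n)) 1) B
    · have hlim := tendsto_const_nhds (x := star B x) |>.sub
        (tendsto_onePlusGram_rpow_neg_one_apply A hAd (star B x))
      rw [sub_zero] at hlim
      exact (B.continuous.tendsto _).comp hlim
  intro X hXN hX U hUN hU
  have hX0 : 0 ≤ X := (ContinuousLinearMap.nonneg_iff_isPositive X).mpr hX
  set S := X ^ (1 / 2 : ℝ) with hS
  have hSN : S ∈ N := N.rpow_mem hXN _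
  have hstar : star S = S := (IsSelfAdjoint.of_nonneg CFC.rpow_nonneg).star_eq
  have hSS : S * S = X := by
    rw [hS, ← CFC.sqrt_eq_rpow]
    exact CFC.sqrt_mul_sqrt_self X hX0
  have h1 := key S hSN
  have h2 := key (U * S) (mul_mem hUN hSN)
  have hUS : star (U * S) * (U * S) = X := by
    rw [star_mul, hstar, mul_assoc, ← mul_assoc (star U), Unitary.star_mul_self_of_mem hU,
      one_mul, hSS]
  have hUS' : U * S * star (U * S) = U * X * star U := by
    rw [star_mul, hstar, mul_assoc, ← mul_assoc S, hSS, mul_assoc]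
  rw [hstar, hSS] at h1
  rw [hUS, hUS'] at h2
  exact tendsto_nhds_unique h2 h1
end

section
/- Let μ be a finite Borel measure on ℝ and let μ^pp denote its pure point part, so that μ^pp(B) = ∑_{x ∈ B} μ({x}) for every Borel set B ⊆ ℝ (the sum over the at most countably many atoms of μ lying in B). For k, n ∈ ℕ let 𝒥^k denote the collection of subsets of ℝ that are unions of exactly k open intervals with rational endpoints, and let |J| denote the Lebesgue measure of J. Then for every Borel set B ⊆ ℝ: μ^pp(B) = lim_{k→∞} lim_{n→∞} sup{ μ(B ∩ J) : J ∈ 𝒥^k, |J| ≤ 1/n }. Equivalently, μ^pp(B) = sup_{k∈ℕ} inf_{n∈ℕ} sup{ μ(B ∩ J) : J ∈ 𝒥^k, |J| ≤ 1/n }, the inner supremum over n being nonincreasing in n and the resulting quantity nondecreasing in k. -/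
open MeasureTheory
open scoped ENNReal

open Set in
/-- An atomless finite measure on `ℝ` is uniformly small on short intervals. -/
theorem exists_pos_forall_measure_Ioo_le (ν : Measure ℝ) [IsFiniteMeasure ν]
    [NullSingletonClass ν]
    {ε : ℝ≥0∞} (hε : ε ≠ 0) :
    ∃ δ : ℝ, 0 < δ ∧ ∀ a b : ℝ, b - a ≤ δ → ν (Ioo a b) ≤ ε := by
  have hU (x : ℝ) : ∃ U ⊇ {x}, IsOpen U ∧ ν U < ε :=
    Set.exists_isOpen_lt_of_lt {x} ε (by simpa using hε.bot_lt)
  choose U hxU hUo hUε using hU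
  obtain ⟨K, -, hK, hKε⟩ :=
    MeasurableSet.univ.exists_isCompact_sdiff_lt (μ := ν) (measure_ne_top _ _) hε
  obtain ⟨δ, hδ, H⟩ := lebesgue_number_lemma_of_metric hK hUo
    fun x _ => mem_iUnion.2 ⟨x, hxU x rfl⟩
  refine ⟨δ, hδ, fun a b hab => ?_⟩
  by_cases h : (Ioo a b ∩ K).Nonempty
  · obtain ⟨x, hx, hxK⟩ := h
    obtain ⟨i, hi⟩ := H x hxK
    refine (measure_mono fun y hy => hi ?_).trans (hUε i).le
    rw [Metric.mem_ball, Real.dist_eq, abs_lt]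
    constructor <;> linarith [hx.1, hx.2, hy.1, hy.2]
  · refine (measure_mono fun y hy => ?_).trans hKε.le
    exact ⟨mem_univ _, fun hyK => h ⟨y, hy, hyK⟩⟩

/-- The atoms of a finite measure form a countable set. -/
theorem countable_setOf_measure_singleton_ne_zero {α : Type*} [MeasurableSpace α]
    [MeasurableSingletonClass α] (μ : Measure α) [IsFiniteMeasure μ] :
    {x | μ {x} ≠ 0}.Countable := by
  have h : ∑' x, μ {x} ≠ ∞ := by
    refine ne_top_of_le_ne_top (measure_ne_top μ Set.univ) ?_
    rw [ENNReal.tsum_eq_iSup_sum]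
    exact iSup_le fun s => sum_measure_singleton.trans_le (measure_mono (Set.subset_univ _))
  exact Summable.countable_support_ennreal h

/-- The atoms of a finite measure lying in `B` have total measure at most the sum of their
masses. -/
theorem measure_inter_atoms_le_tsum {α : Type*} [MeasurableSpace α]
    [MeasurableSingletonClass α] (μ : Measure α) [IsFiniteMeasure μ] (B : Set α) :
    μ (B ∩ {x | μ {x} ≠ 0}) ≤ ∑' x : B, μ {(x : α)} := by
  have hc := (countable_setOf_measure_singleton_ne_zero μ).mono (Set.inter_subset_right (s := B))
  calc μ (B ∩ {x | μ {x} ≠ 0})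
      = μ (⋃ x ∈ B ∩ {x | μ {x} ≠ 0}, {x}) := by rw [Set.biUnion_of_singleton]
    _ ≤ ∑' x : ↑(B ∩ {x | μ {x} ≠ 0}), μ {(x : α)} := measure_biUnion_le μ hc _
    _ ≤ ∑' x : B, μ {(x : α)} :=
      ENNReal.tsum_mono_subtype (fun x => μ {x}) Set.inter_subset_left

/-- Removing the atoms of a finite measure leaves an atomless measure. -/
theorem nullSingletonClass_restrict_compl_atoms {α : Type*} [MeasurableSpace α]
    [MeasurableSingletonClass α] (μ : Measure α) :
    NullSingletonClass (μ.restrict {x | μ {x} ≠ 0}ᶜ) := by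
  refine ⟨fun x => ?_⟩
  rw [Measure.restrict_apply (measurableSet_singleton x)]
  by_cases hx : μ {x} = 0
  · exact measure_mono_null Set.inter_subset_left hx
  · convert measure_empty (μ := μ)
    ext y
    simp only [Set.mem_inter_iff, Set.mem_singleton_iff, Set.mem_compl_iff, Set.mem_ofPred_eq,
      not_not, Set.mem_empty_iff_false, iff_false, not_and]
    rintro rfl
    exact hx

/-- A finite set of reals is covered by as many rational intervals of small total length. -/
theorem exists_rat_Ioo_cover (s : Finset ℝ) {ε : ℝ≥0∞} (hε : ε ≠ 0) :
    ∃ a b : Fin s.card → ℚ, (s : Set ℝ) ⊆ ⋃ i, Set.Ioo (a i : ℝ) (b i) ∧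
      volume (⋃ i, Set.Ioo (a i : ℝ) (b i)) ≤ ε := by
  obtain ⟨δ, hδ, hδε⟩ := ENNReal.exists_nnreal_pos_mul_lt (ENNReal.natCast_ne_top s.card) hε
  have hδ' : (0 : ℝ) < δ / 2 := half_pos (NNReal.coe_pos.2 hδ)
  choose a ha using fun x : ℝ => exists_rat_btwn (sub_lt_self x hδ')
  choose b hb using fun x : ℝ => exists_rat_btwn (lt_add_of_pos_right x hδ')
  refine ⟨fun i => a (s.equivFin.symm i), fun i => b (s.equivFin.symm i), fun x hx => ?_, ?_⟩
  · refine Set.mem_iUnion.2 ⟨s.equivFin ⟨x, hx⟩, ?_⟩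
    simpa using ⟨(ha x).2, (hb x).1⟩
  · refine (measure_iUnion_fintype_le _ _).trans (le_trans ?_ hδε.le)
    calc _ ≤ ∑ _i : Fin s.card, (δ : ℝ≥0∞) := by
          refine Finset.sum_le_sum fun i _ => ?_
          rw [Real.volume_Ioo, ← ENNReal.ofReal_coe_nnreal]
          refine ENNReal.ofReal_le_ofReal ?_
          linarith [(ha (s.equivFin.symm i)).1, (hb (s.equivFin.symm i)).2]
      _ = δ * s.card := by simp [mul_comm]

/-- for a finite Borel measure `μ` on `ℝ` with pure point part
`μ^pp(B) = ∑_{x ∈ B} μ{x}`, and `𝒥^k` the collection of unions of `k` open intervals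
with rational endpoints, one has for every Borel set `B`:
`μ^pp(B) = sup_k inf_n sup { μ(B ∩ J) : J ∈ 𝒥^k, |J| ≤ 1/n }`,
where `|J|` denotes Lebesgue measure. -/
theorem pure_point_part_formula
    (μ : Measure ℝ) [IsFiniteMeasure μ] (B : Set ℝ) (hB : MeasurableSet B) :
    (∑' x : B, μ {(x : ℝ)}) =
      ⨆ k : ℕ, ⨅ n : ℕ, ⨆ (J : Set ℝ)
        (_ : (∃ a b : Fin k → ℚ, J = ⋃ i, Set.Ioo (a i : ℝ) (b i)) ∧
          volume J ≤ ((n : ℝ≥0∞))⁻¹), μ (B ∩ J) := by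
  apply le_antisymm
  · rw [ENNReal.tsum_eq_iSup_sum]
    refine iSup_le fun s => ?_
    set t : Finset ℝ := s.map (Function.Embedding.subtype _) with ht
    have htB : (t : Set ℝ) ⊆ B := by
      intro x hx
      obtain ⟨y, -, rfl⟩ := Finset.mem_map.1 (Finset.mem_coe.1 hx)
      exact y.2
    refine le_iSup_of_le t.card (le_iInf fun n => ?_)
    obtain ⟨a, b, hcov, hvol⟩ :=
      exists_rat_Ioo_cover t (ENNReal.inv_ne_zero.2 (ENNReal.natCast_ne_top n))
    refine le_iSup₂_of_le _ ⟨⟨a, b, rfl⟩, hvol⟩ ?_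
    calc ∑ x ∈ s, μ {(x : ℝ)} = ∑ x ∈ t, μ {x} := by simp [ht]
      _ = μ t := sum_measure_singleton
      _ ≤ _ := measure_mono (Set.subset_inter htB hcov)
  · refine iSup_le fun k => ENNReal.le_of_forall_pos_le_add fun ε hε _ => ?_
    set A : Set ℝ := {x | μ {x} ≠ 0} with hA
    have : NullSingletonClass (μ.restrict Aᶜ) := nullSingletonClass_restrict_compl_atoms μ
    obtain ⟨η, hη, hηε⟩ := ENNReal.exists_nnreal_pos_mul_lt (ENNReal.natCast_ne_top k)
      (ENNReal.coe_ne_zero.2 hε.ne')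
    obtain ⟨δ, hδ, H⟩ := exists_pos_forall_measure_Ioo_le (μ.restrict Aᶜ)
      (ENNReal.coe_ne_zero.2 hη.ne')
    obtain ⟨n, hn⟩ := ENNReal.exists_inv_nat_lt (ENNReal.ofReal_pos.2 hδ).ne'
    refine iInf_le_of_le n (iSup₂_le ?_)
    rintro J ⟨⟨a, b, rfl⟩, hvol⟩
    have hI (i : Fin k) : μ.restrict Aᶜ (Set.Ioo (a i : ℝ) (b i)) ≤ η := by
      refine H _ _ ((ENNReal.ofReal_le_ofReal_iff hδ.le).1 ?_)
      rw [← Real.volume_Ioo]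
      exact ((measure_mono (Set.subset_iUnion (fun i => Set.Ioo (a i : ℝ) (b i)) i)).trans
        hvol).trans hn.le
    set J : Set ℝ := ⋃ i, Set.Ioo (a i : ℝ) (b i) with hJ
    have hJm : MeasurableSet J := MeasurableSet.iUnion fun i => measurableSet_Ioo
    calc μ (B ∩ J) ≤ μ (B ∩ A ∪ J ∩ Aᶜ) := by
          refine measure_mono fun x hx => ?_
          by_cases hxA : x ∈ A
          · exact Or.inl ⟨hx.1, hxA⟩
          · exact Or.inr ⟨hx.2, hxA⟩
      _ ≤ μ (B ∩ A) + μ (J ∩ Aᶜ) := measure_union_le _ _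
      _ ≤ (∑' x : B, μ {(x : ℝ)}) + ε := by
          refine add_le_add (measure_inter_atoms_le_tsum μ B) ?_
          rw [← Measure.restrict_apply hJm]
          calc μ.restrict Aᶜ J ≤ ∑ i : Fin k, μ.restrict Aᶜ (Set.Ioo (a i : ℝ) (b i)) :=
                measure_iUnion_fintype_le _ _
            _ ≤ ∑ _i : Fin k, (η : ℝ≥0∞) := Finset.sum_le_sum fun i _ => hI i
            _ = η * k := by simp [mul_comm]
            _ ≤ ε := hηε.le
end

section
/- Let μ₁ and μ₂ be Borel measures on ℝ which vanish on (−∞, 0) (i.e. μ_j((−∞,0)) = 0 for j = 1,2) such that for every t > 0 the Laplace transforms ∫_{[0,∞)} e^{−tλ} dμ_j(λ), j = 1,2, are finite, and ∫_{[0,∞)} e^{−tλ} dμ₁(λ) = ∫_{[0,∞)} e^{−tλ} dμ₂(λ) for all t > 0. Then μ₁ = μ₂. In particular, if f₁, f₂ : (0,∞) → ℝ are the associated monotonously increasing distribution functions with lim_{λ↘0} f_j(λ) = 0 (so that μ_j is the Lebesgue–Stieltjes measure of f_j), then f₁ and f₂ have the same set of continuity points and f₁(λ₀) = f₂(λ₀)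 at every common continuity point λ₀. -/
open MeasureTheory Filter
open scoped ENNReal Topology

/-- Two measures on `ℝ` whose exponential integrals `∫ e^{tx} dμ` are finite and agree for all `t`
in a left half-line containing `0` in its interior are equal. -/
theorem MeasureTheory.Measure.ext_of_lintegral_exp_eq {μ ν : Measure ℝ} {a : ℝ} (ha : 0 < a)
    (hμ : ∀ t < a, ∫⁻ x, ENNReal.ofReal (Real.exp (t * x)) ∂μ < ∞)
    (h : ∀ t < a, ∫⁻ x, ENNReal.ofReal (Real.exp (t * x)) ∂μ =
      ∫⁻ x, ENNReal.ofReal (Real.exp (t * x)) ∂ν) :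
    μ = ν := by
  have hν : ∀ t < a, ∫⁻ x, ENNReal.ofReal (Real.exp (t * x)) ∂ν < ∞ :=
    fun t ht ↦ h t ht ▸ hμ t ht
  have : IsFiniteMeasure μ := ⟨by simpa using hμ 0 ha⟩
  have : IsFiniteMeasure ν := ⟨by simpa using hν 0 ha⟩
  have sub {ρ : Measure ℝ} (hρ : ∀ t < a, ∫⁻ x, ENNReal.ofReal (Real.exp (t * x)) ∂ρ < ∞) :
      Set.Iio a ⊆ interior (ProbabilityTheory.integrableExpSet id ρ) := by
    refine interior_maximal (fun t ht ↦ ?_) isOpen_Iio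
    refine ⟨by fun_prop, ?_⟩
    rw [hasFiniteIntegral_iff_ofReal (ae_of_all _ fun x ↦ (Real.exp_pos _).le)]
    exact hρ t ht
  have han {ρ : Measure ℝ} (hρ : ∀ t < a, ∫⁻ x, ENNReal.ofReal (Real.exp (t * x)) ∂ρ < ∞) :
      AnalyticOnNhd ℂ (ProbabilityTheory.complexMGF id ρ) {z | z.re < a} :=
    ProbabilityTheory.analyticOnNhd_complexMGF.mono fun z hz ↦ sub hρ hz
  have hmgf (t : ℝ) (ht : t < a) :
      ProbabilityTheory.complexMGF id μ t = ProbabilityTheory.complexMGF id ν t := by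
    rw [ProbabilityTheory.complexMGF_ofReal, ProbabilityTheory.complexMGF_ofReal,
      ProbabilityTheory.mgf, ProbabilityTheory.mgf,
      integral_eq_lintegral_of_nonneg_ae (ae_of_all _ fun x ↦ (Real.exp_pos _).le) (by fun_prop),
      integral_eq_lintegral_of_nonneg_ae (ae_of_all _ fun x ↦ (Real.exp_pos _).le) (by fun_prop)]
    exact congrArg (fun y : ℝ≥0∞ ↦ (y.toReal : ℂ)) (h t ht)
  have hreal : ∃ᶠ t : ℝ in 𝓝[≠] 0,
      ProbabilityTheory.complexMGF id μ t = ProbabilityTheory.complexMGF id ν t :=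
    (((eventually_lt_nhds ha).filter_mono nhdsWithin_le_nhds).mono hmgf).frequently
  have htendsto : Tendsto ((↑) : ℝ → ℂ) (𝓝[≠] 0) (𝓝[≠] 0) := by
    refine tendsto_nhdsWithin_iff.2 ⟨?_, ?_⟩
    · exact (Complex.continuous_ofReal.tendsto' 0 0 (by simp)).mono_left nhdsWithin_le_nhds
    · filter_upwards [self_mem_nhdsWithin] with t ht
      simpa using ht
  have heqOn := (han hμ).eqOn_of_preconnected_of_frequently_eq (han hν)
    (convex_halfSpace_re_lt a).isPreconnected (z₀ := 0) (by simpa using ha)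
    (htendsto.frequently hreal)
  refine Measure.ext_of_charFun (funext fun t ↦ ?_)
  rw [← ProbabilityTheory.complexMGF_id_mul_I, ← ProbabilityTheory.complexMGF_id_mul_I]
  exact heqOn (by simpa using ha)

/-- A Laplace transform, finite and known on `(0, ∞)`, determines the measure. -/
theorem MeasureTheory.Measure.ext_of_lintegral_exp_neg_eq {μ ν : Measure ℝ}
    (hμ : ∀ t : ℝ, 0 < t → ∫⁻ x, ENNReal.ofReal (Real.exp (-t * x)) ∂μ < ∞)
    (h : ∀ t : ℝ, 0 < t → ∫⁻ x, ENNReal.ofReal (Real.exp (-t * x)) ∂μ =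
      ∫⁻ x, ENNReal.ofReal (Real.exp (-t * x)) ∂ν) :
    μ = ν := by
  let w : ℝ → ℝ≥0∞ := fun x ↦ ENNReal.ofReal (Real.exp (-x))
  have hw : Measurable w := by fun_prop
  have hw_inv (ρ : Measure ℝ) : (ρ.withDensity w).withDensity (fun x ↦ (w x)⁻¹) = ρ :=
    withDensity_inv_same hw (ae_of_all _ fun x ↦ by simp [w, Real.exp_pos])
      (ae_of_all _ fun x ↦ by simp [w])
  have key (ρ : Measure ℝ) (t : ℝ) :
      ∫⁻ x, ENNReal.ofReal (Real.exp (t * x)) ∂(ρ.withDensity w) =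
        ∫⁻ x, ENNReal.ofReal (Real.exp (-(1 - t) * x)) ∂ρ := by
    rw [lintegral_withDensity_eq_lintegral_mul _ hw (by fun_prop)]
    refine lintegral_congr fun x ↦ ?_
    rw [Pi.mul_apply, ← ENNReal.ofReal_mul (Real.exp_pos _).le, ← Real.exp_add]
    ring_nf
  have heq : μ.withDensity w = ν.withDensity w := by
    refine Measure.ext_of_lintegral_exp_eq one_pos (fun t ht ↦ ?_) (fun t ht ↦ ?_)
    · exact key μ t ▸ hμ _ (sub_pos.2 ht)
    · exact (key μ t).trans ((h _ (sub_pos.2 ht)).trans (key ν t).symm)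
  rw [← hw_inv μ, heq, hw_inv]

/-- A function monotone on `(0, ∞)` with limit `0` at `0` from the right is nonnegative there. -/
theorem MonotoneOn.nonneg_of_tendsto_nhdsGT_zero {f : ℝ → ℝ} (hf : MonotoneOn f (Set.Ioi 0))
    (hlim : Tendsto f (𝓝[>] 0) (𝓝 0)) {x : ℝ} (hx : 0 < x) : 0 ≤ f x := by
  refine le_of_tendsto hlim ?_
  filter_upwards [Ioo_mem_nhdsGT hx] with y hy
  exact hf hy.1 hx hy.2.le

/-- uniqueness lemma for the Laplace transform: if two Borel
measures on `ℝ` vanishing on `(−∞, 0)` have finite and equal Laplace transforms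
`∫_{[0,∞)} e^{−tλ} dμ_j(λ)` for all `t > 0`, then `μ₁ = μ₂`. In particular, if
`f₁, f₂ : (0,∞) → ℝ` are associated monotone increasing distribution functions with
`f_j(λ) ↘ 0` as `λ ↘ 0` (so that `μ_j` has `f_j` as its distribution function, here
encoded by `μ_j((−∞, λ)) = f_j(λ)` for `λ > 0`), then `f₁` and `f₂` have the same
continuity points and agree at every common continuity point. -/
theorem laplace_transform_uniqueness
    (μ₁ μ₂ : Measure ℝ)
    (h₁ : μ₁ (Set.Iio 0) = 0) (h₂ : μ₂ (Set.Iio 0) = 0)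
    (hfin₁ : ∀ t : ℝ, 0 < t →
      ∫⁻ x in Set.Ici (0 : ℝ), ENNReal.ofReal (Real.exp (-t * x)) ∂μ₁ < ∞)
    (hfin₂ : ∀ t : ℝ, 0 < t →
      ∫⁻ x in Set.Ici (0 : ℝ), ENNReal.ofReal (Real.exp (-t * x)) ∂μ₂ < ∞)
    (heq : ∀ t : ℝ, 0 < t →
      ∫⁻ x in Set.Ici (0 : ℝ), ENNReal.ofReal (Real.exp (-t * x)) ∂μ₁ =
      ∫⁻ x in Set.Ici (0 : ℝ), ENNReal.ofReal (Real.exp (-t * x)) ∂μ₂) :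
    μ₁ = μ₂ ∧
    ∀ f₁ f₂ : ℝ → ℝ,
      MonotoneOn f₁ (Set.Ioi 0) → MonotoneOn f₂ (Set.Ioi 0) →
      Tendsto f₁ (𝓝[>] 0) (𝓝 0) → Tendsto f₂ (𝓝[>] 0) (𝓝 0) →
      (∀ x : ℝ, 0 < x → μ₁ (Set.Iio x) = ENNReal.ofReal (f₁ x)) →
      (∀ x : ℝ, 0 < x → μ₂ (Set.Iio x) = ENNReal.ofReal (f₂ x)) →
      ∀ x : ℝ, 0 < x →
        (ContinuousWithinAt f₁ (Set.Ioi 0) x ↔ ContinuousWithinAt f₂ (Set.Ioi 0) x) ∧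
        (ContinuousWithinAt f₁ (Set.Ioi 0) x → f₁ x = f₂ x) := by
  have hμ : μ₁ = μ₂ := by
    have hr {ρ : Measure ℝ} (hρ : ρ (Set.Iio 0) = 0) : ρ.restrict (Set.Ici 0) = ρ :=
      Measure.restrict_eq_self_of_ae_mem (by
        rw [ae_iff]; simpa [Set.Iio_def] using hρ)
    rw [hr h₁] at hfin₁ heq
    rw [hr h₂] at heq
    exact Measure.ext_of_lintegral_exp_neg_eq hfin₁ heq
  refine ⟨hμ, fun f₁ f₂ hm₁ hm₂ hl₁ hl₂ hf₁ hf₂ x hx ↦ ?_⟩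
  have hf : Set.EqOn f₁ f₂ (Set.Ioi 0) := fun y hy ↦ by
    rw [← ENNReal.ofReal_eq_ofReal_iff (hm₁.nonneg_of_tendsto_nhdsGT_zero hl₁ hy)
      (hm₂.nonneg_of_tendsto_nhdsGT_zero hl₂ hy), ← hf₁ y hy, ← hf₂ y hy, hμ]
  exact ⟨continuousWithinAt_congr hf (hf hx), fun _ ↦ hf hx⟩
end

section
/- Let μ₁ and μ₂ be Borel measures on ℝ which vanish on (−∞, 0) such that for every t > 0 the Laplace transforms ∫_{[0,∞)} e^{−tλ} dμ_j(λ), j = 1,2, are finite and equal: ∫_{[0,∞)} e^{−tλ} dμ₁(λ) = ∫_{[0,∞)} e^{−tλ} dμ₂(λ) for all t > 0. Then for every continuous function g : ℝ → ℝ with compact support, ∫ g(λ) dμ₁(λ) = ∫ g(λ) dμ₂(λ). -/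
open MeasureTheory
open scoped ENNReal

/-- Two finite measures on `ℝ` whose moment-generating functions are finite and coincide on a
neighbourhood of `0` are equal. -/
theorem ext_of_mgf_id_eventuallyEq {μ ν : Measure ℝ} [IsFiniteMeasure μ] [IsFiniteMeasure ν]
    (hμ : 0 ∈ interior (ProbabilityTheory.integrableExpSet id μ))
    (hν : 0 ∈ interior (ProbabilityTheory.integrableExpSet id ν))
    (h : ∀ᶠ t in nhds 0, ProbabilityTheory.mgf id μ t = ProbabilityTheory.mgf id ν t) :
    μ = ν := by
  open ProbabilityTheory in
  set S := interior (integrableExpSet id μ) ∩ interior (integrableExpSet id ν)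
  have hEq : Set.EqOn (complexMGF id μ) (complexMGF id ν) {z : ℂ | z.re ∈ S} := by
    refine AnalyticOnNhd.eqOn_of_preconnected_of_frequently_eq (z₀ := 0)
      (analyticOnNhd_complexMGF.mono fun z hz ↦ hz.1)
      (analyticOnNhd_complexMGF.mono fun z hz ↦ hz.2)
      ((convex_integrableExpSet.interior.inter convex_integrableExpSet.interior).linear_preimage
        Complex.reLm).isPreconnected ⟨hμ, hν⟩ ?_
    have hreal : ∃ᶠ t : ℝ in nhdsWithin 0 {0}ᶜ, complexMGF id μ t = complexMGF id ν t :=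
      ((h.filter_mono nhdsWithin_le_nhds).mono fun t ht ↦ by
        rw [complexMGF_ofReal, complexMGF_ofReal, ht]).frequently
    have htend : Filter.Tendsto ((↑) : ℝ → ℂ) (nhdsWithin 0 {0}ᶜ) (nhdsWithin 0 {0}ᶜ) := by
      refine tendsto_nhdsWithin_iff.2 ⟨?_, ?_⟩
      · exact (Complex.continuous_ofReal.tendsto' 0 0 (by simp)).mono_left nhdsWithin_le_nhds
      · filter_upwards [self_mem_nhdsWithin] with t ht using by simpa using ht
    exact htend.frequently hreal
  refine Measure.ext_of_charFun (funext fun t ↦ ?_)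
  rw [← complexMGF_id_mul_I, ← complexMGF_id_mul_I]
  exact hEq (by simpa using ⟨hμ, hν⟩)

/-- A Borel measure on `ℝ` concentrated on `[0, ∞)` with finite Laplace transform on `(0, ∞)` is
determined by it. -/
theorem ext_of_laplace_transform_eq {μ₁ μ₂ : Measure ℝ}
    (h₁ : μ₁ (Set.Iio 0) = 0) (h₂ : μ₂ (Set.Iio 0) = 0)
    (hfin : ∀ t : ℝ, 0 < t →
      ∫⁻ x in Set.Ici (0 : ℝ), ENNReal.ofReal (Real.exp (-t * x)) ∂μ₁ < ∞)
    (heq : ∀ t : ℝ, 0 < t →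
      ∫⁻ x in Set.Ici (0 : ℝ), ENNReal.ofReal (Real.exp (-t * x)) ∂μ₁ =
      ∫⁻ x in Set.Ici (0 : ℝ), ENNReal.ofReal (Real.exp (-t * x)) ∂μ₂) :
    μ₁ = μ₂ := by
  open ProbabilityTheory in
  have restrict_Ici {μ : Measure ℝ} (h : μ (Set.Iio 0) = 0) : μ.restrict (Set.Ici 0) = μ :=
    Measure.restrict_eq_self_of_ae_mem <| by
      rw [ae_iff]; simpa [Set.Iio_def] using h
  rw [restrict_Ici h₁, restrict_Ici h₂] at heq
  rw [restrict_Ici h₁] at hfin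
  set w : ℝ → ℝ≥0∞ := fun x ↦ ENNReal.ofReal (Real.exp (-x))
  have hw : Measurable w := by fun_prop
  have lintegral_exp (μ : Measure ℝ) (s : ℝ) :
      ∫⁻ x, ENNReal.ofReal (Real.exp (s * x)) ∂μ.withDensity w =
        ∫⁻ x, ENNReal.ofReal (Real.exp (-(1 - s) * x)) ∂μ := by
    rw [lintegral_withDensity_eq_lintegral_mul _ hw (by fun_prop)]
    refine lintegral_congr fun x ↦ ?_
    rw [Pi.mul_apply, ← ENNReal.ofReal_mul (Real.exp_pos _).le, ← Real.exp_add]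
    ring_nf
  have zero_mem {μ : Measure ℝ}
      (h : ∀ t : ℝ, 0 < t → ∫⁻ x, ENNReal.ofReal (Real.exp (-t * x)) ∂μ < ∞) :
      0 ∈ interior (integrableExpSet id (μ.withDensity w)) := by
    refine mem_interior.2 ⟨Set.Iio 1, fun s hs ↦ ?_, isOpen_Iio, by simp⟩
    refine ⟨by fun_prop, ?_⟩
    rw [hasFiniteIntegral_iff_ofReal (.of_forall fun x ↦ (Real.exp_pos _).le)]
    simpa only [id, lintegral_exp] using h (1 - s) (sub_pos.2 hs)
  have finite {μ : Measure ℝ}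
      (h : ∀ t : ℝ, 0 < t → ∫⁻ x, ENNReal.ofReal (Real.exp (-t * x)) ∂μ < ∞) :
      IsFiniteMeasure (μ.withDensity w) :=
    isFiniteMeasure_withDensity (by simpa [w] using (h 1 one_pos).ne)
  have hfin' := fun t ht ↦ (heq t ht) ▸ hfin t ht
  have := finite hfin
  have := finite hfin'
  have key : μ₁.withDensity w = μ₂.withDensity w := by
    refine ext_of_mgf_id_eventuallyEq (zero_mem hfin) (zero_mem hfin') ?_
    filter_upwards [Iio_mem_nhds (zero_lt_one' ℝ)] with s hs
    simp only [mgf, id]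
    rw [integral_eq_lintegral_of_nonneg_ae (.of_forall fun x ↦ (Real.exp_pos _).le) (by fun_prop),
      integral_eq_lintegral_of_nonneg_ae (.of_forall fun x ↦ (Real.exp_pos _).le) (by fun_prop),
      lintegral_exp, lintegral_exp, heq _ (sub_pos.2 hs)]
  have recover (μ : Measure ℝ) : (μ.withDensity w).withDensity w⁻¹ = μ :=
    withDensity_inv_same hw (.of_forall fun x ↦ by simp [w, Real.exp_pos])
      (.of_forall fun x ↦ ENNReal.ofReal_ne_top)
  rw [← recover μ₁, key, recover]

/-- corollary of the uniqueness lemma: if two Borel measures on `ℝ`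
vanishing on `(−∞, 0)` have finite and equal Laplace transforms
`∫_{[0,∞)} e^{−tλ} dμ_j(λ)` for all `t > 0`, then they integrate every continuous
compactly supported function equally. -/
theorem laplace_transform_unique_integrals
    (μ₁ μ₂ : Measure ℝ)
    (h₁ : μ₁ (Set.Iio 0) = 0) (h₂ : μ₂ (Set.Iio 0) = 0)
    (hfin₁ : ∀ t : ℝ, 0 < t →
      ∫⁻ x in Set.Ici (0 : ℝ), ENNReal.ofReal (Real.exp (-t * x)) ∂μ₁ < ∞)
    (hfin₂ : ∀ t : ℝ, 0 < t →
      ∫⁻ x in Set.Ici (0 : ℝ), ENNReal.ofReal (Real.exp (-t * x)) ∂μ₂ < ∞)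
    (heq : ∀ t : ℝ, 0 < t →
      ∫⁻ x in Set.Ici (0 : ℝ), ENNReal.ofReal (Real.exp (-t * x)) ∂μ₁ =
      ∫⁻ x in Set.Ici (0 : ℝ), ENNReal.ofReal (Real.exp (-t * x)) ∂μ₂) :
    ∀ g : ℝ → ℝ, Continuous g → HasCompactSupport g →
      ∫ x, g x ∂μ₁ = ∫ x, g x ∂μ₂ := by
  intro g _ _
  rw [ext_of_laplace_transform_eq h₁ h₂ hfin₁ heq]
end
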